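/- There exist absolute constants C′, C₀ > 0 and n₀ such that for all n ≥ n₀ the following holds. Let G be sampled from SBM(n,k,p,q) with 0 < q < p ≤ 3/4, σ² ≥ C₀·log n/n, where every cluster has size at least n/(2k), and suppose (p−q)·√(n/k) > C′·σ·√k·log n. Then there exists a (measurable) estimator that, with probability at least 1 − O(1/n) over G, outputs exactly the entire hidden partition {V₁,…,V_k}. -/

import Mathlib

open MeasureTheory

noncomputable def bern (p : ℝ) : Measure Bool :=
  ENNReal.ofReal p • Measure.dirac true + ENNReal.ofReal (1 - p) • Measure.dirac false

noncomputable def sbm (n k : ℕ) (c : Fin n → Fin k) (p q : ℝ) :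
    Measure ({e : Fin n × Fin n // e.1 < e.2} → Bool) :=
  Measure.pi fun e => bern (if c e.1.1 = c e.1.2 then p else q)

def clusterF {n k : ℕ} (c : Fin n → Fin k) (i : Fin k) : Finset (Fin n) :=
  Finset.univ.filter fun v => c v = i

noncomputable def sigSBM (p q : ℝ) : ℝ :=
  max (Real.sqrt (p * (1 - p))) (Real.sqrt (q * (1 - q)))

lemma isProbabilityMeasure_bern {p : ℝ} (h₀ : 0 ≤ p) (h₁ : p ≤ 1) :
    IsProbabilityMeasure (bern p) := by
  constructor
  simp only [bern, Measure.add_apply, Measure.smul_apply, measure_univ, smul_eq_mul, mul_one]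
  rw [← ENNReal.ofReal_add h₀ (by linarith)]
  simp

lemma integral_bern {p : ℝ} (h₀ : 0 ≤ p) (h₁ : p ≤ 1) (f : Bool → ℝ) :
    ∫ b, f b ∂bern p = p * f true + (1 - p) * f false := by
  have := isProbabilityMeasure_bern h₀ h₁
  rw [integral_fintype Integrable.of_finite]
  simp [bern, Measure.real, h₀, h₁]

/-- Centred number of edges inside the clusters of `c`. -/
noncomputable def score {n k : ℕ} (θ : ℝ) (c : Fin n → Fin k)
    (G : {e : Fin n × Fin n // e.1 < e.2} → Bool) : ℝ :=
  ∑ e, if c e.1.1 = c e.1.2 then (if G e then 1 else 0) - θ else 0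

/-- The pairs which exactly one of the two clusterings puts in a common cluster. -/
def pairDiff {n k : ℕ} (c c' : Fin n → Fin k) : Finset {e : Fin n × Fin n // e.1 < e.2} :=
  Finset.univ.filter fun e => ¬(c e.1.1 = c e.1.2 ↔ c' e.1.1 = c' e.1.2)

lemma mgf_present_le {p q : ℝ} (hq : 0 < q) (hqp : q < p) :
    p * Real.exp ((p - q) / (4 * p) * (-(1 - (p + q) / 2))) +
      (1 - p) * Real.exp ((p - q) / (4 * p) * (-(0 - (p + q) / 2))) ≤
      Real.exp (-((p - q) ^ 2 / (16 * p))) := by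
  have hp : 0 < p := hq.trans hqp
  set l := (p - q) / (4 * p) with hl
  have hlp : p * l = (p - q) / 4 := by rw [hl]; field_simp
  have hl0 : 0 < l := by rw [hl]; exact div_pos (by linarith) (by linarith)
  have hl1 : l ≤ 1 := by nlinarith
  have hsq : (p - q) ^ 2 / (16 * p) = p * l ^ 2 := by rw [hl]; field_simp; norm_num
  have h1 : Real.exp (l * (-(1 - (p + q) / 2))) =
      Real.exp (l * ((p + q) / 2)) * Real.exp (-l) := by
    rw [← Real.exp_add]; congr 1; ring
  have h2 : Real.exp (l * (-(0 - (p + q) / 2))) = Real.exp (l * ((p + q) / 2)) := by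
    congr 1; ring
  have hb := (abs_le.1 (Real.abs_exp_sub_one_sub_id_le (x := -l)
    (by rw [abs_neg, abs_of_pos hl0]; exact hl1))).2
  have h3 : p * Real.exp (-l) + (1 - p) ≤ Real.exp (-(p * l) + p * l ^ 2) := by
    have := Real.add_one_le_exp (-(p * l) + p * l ^ 2)
    nlinarith
  calc _ = Real.exp (l * ((p + q) / 2)) * (p * Real.exp (-l) + (1 - p)) := by rw [h1, h2]; ring
    _ ≤ Real.exp (l * ((p + q) / 2)) * Real.exp (-(p * l) + p * l ^ 2) := by gcongr
    _ = _ := by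
      rw [← Real.exp_add, hsq]; congr 1
      linear_combination (2 * l) * hlp

lemma mgf_absent_le {p q : ℝ} (hq : 0 < q) (hqp : q < p) :
    q * Real.exp ((p - q) / (4 * p) * (1 - (p + q) / 2)) +
      (1 - q) * Real.exp ((p - q) / (4 * p) * (0 - (p + q) / 2)) ≤
      Real.exp (-((p - q) ^ 2 / (16 * p))) := by
  have hp : 0 < p := hq.trans hqp
  set l := (p - q) / (4 * p) with hl
  have hlp : p * l = (p - q) / 4 := by rw [hl]; field_simp
  have hl0 : 0 < l := by rw [hl]; exact div_pos (by linarith) (by linarith)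
  have hl1 : l ≤ 1 := by nlinarith
  have hsq : (p - q) ^ 2 / (16 * p) = p * l ^ 2 := by rw [hl]; field_simp; norm_num
  have h1 : Real.exp (l * (1 - (p + q) / 2)) =
      Real.exp (-(l * ((p + q) / 2))) * Real.exp l := by
    rw [← Real.exp_add]; congr 1; ring
  have h2 : Real.exp (l * (0 - (p + q) / 2)) = Real.exp (-(l * ((p + q) / 2))) := by
    congr 1; ring
  have hb := (abs_le.1 (Real.abs_exp_sub_one_sub_id_le (x := l)
    (by rw [abs_of_pos hl0]; exact hl1))).2
  have h3 : q * Real.exp l + (1 - q) ≤ Real.exp (q * l + p * l ^ 2) := by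
    have := Real.add_one_le_exp (q * l + p * l ^ 2)
    have : q * l ^ 2 ≤ p * l ^ 2 := by gcongr
    nlinarith
  calc _ = Real.exp (-(l * ((p + q) / 2))) * (q * Real.exp l + (1 - q)) := by rw [h1, h2]; ring
    _ ≤ Real.exp (-(l * ((p + q) / 2))) * Real.exp (q * l + p * l ^ 2) := by gcongr
    _ = _ := by
      rw [← Real.exp_add, hsq]; congr 1
      linear_combination (2 * l) * hlp

lemma isProbabilityMeasure_sbm {n k : ℕ} (c : Fin n → Fin k) {p q : ℝ} (hq : 0 < q) (hqp : q < p)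
    (hp1 : p ≤ 1) : IsProbabilityMeasure (sbm n k c p q) := by
  have (e : {e : Fin n × Fin n // e.1 < e.2}) :
      IsProbabilityMeasure (bern (if c e.1.1 = c e.1.2 then p else q)) := by
    split_ifs
    · exact isProbabilityMeasure_bern (by linarith) hp1
    · exact isProbabilityMeasure_bern hq.le (by linarith)
  unfold sbm
  infer_instance

/-- A competitor beats the true clustering with probability exponentially small in the number of
misclassified pairs. -/
lemma sbm_score_le_score {n k : ℕ} (c c' : Fin n → Fin k) {p q : ℝ} (hq : 0 < q) (hqp : q < p)
    (hp1 : p ≤ 1) :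
    (sbm n k c p q).real {G | score ((p + q) / 2) c G ≤ score ((p + q) / 2) c' G} ≤
      Real.exp (-((p - q) ^ 2 / (16 * p)) * (pairDiff c c').card) := by
  have hp : 0 < p := hq.trans hqp
  have (e : {e : Fin n × Fin n // e.1 < e.2}) :
      IsProbabilityMeasure (bern (if c e.1.1 = c e.1.2 then p else q)) := by
    split_ifs
    · exact isProbabilityMeasure_bern hp.le hp1
    · exact isProbabilityMeasure_bern hq.le (by linarith)
  have := isProbabilityMeasure_sbm c hq hqp hp1
  set θ := (p + q) / 2 with hθ
  set l := (p - q) / (4 * p) with hl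
  have hl0 : 0 < l := div_pos (by linarith) (by linarith)
  let x (c : Fin n → Fin k) (e : {e : Fin n × Fin n // e.1 < e.2}) (b : Bool) : ℝ :=
    if c e.1.1 = c e.1.2 then (if b then 1 else 0) - θ else 0
  let F (e : {e : Fin n × Fin n // e.1 < e.2}) (b : Bool) : ℝ := Real.exp (l * (x c' e b - x c e b))
  have hF (G : {e : Fin n × Fin n // e.1 < e.2} → Bool) :
      ∏ e, F e (G e) = Real.exp (l * (score θ c' G - score θ c G)) := by
    simp only [F, ← Real.exp_sum, ← Finset.mul_sum, Finset.sum_sub_distrib]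
    rfl
  have hsub : {G | score θ c G ≤ score θ c' G} ⊆
      {G : {e : Fin n × Fin n // e.1 < e.2} → Bool | 1 ≤ ∏ e, F e (G e)} := by
    intro G hG
    simp only [Set.mem_ofPred_eq] at hG ⊢
    rw [hF]
    exact Real.one_le_exp (mul_nonneg hl0.le (by linarith))
  have hfac (e) : ∫ b, F e b ∂bern (if c e.1.1 = c e.1.2 then p else q) ≤
      if e ∈ pairDiff c c' then Real.exp (-((p - q) ^ 2 / (16 * p))) else 1 := by
    rw [integral_bern (by split_ifs <;> linarith) (by split_ifs <;> linarith)]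
    by_cases h : c e.1.1 = c e.1.2 <;> by_cases h' : c' e.1.1 = c' e.1.2
    · simp [F, x, pairDiff, h, h']
    · simpa [F, x, pairDiff, h, h'] using mgf_present_le hq hqp
    · simpa [F, x, pairDiff, h, h'] using mgf_absent_le hq hqp
    · simp [F, x, pairDiff, h, h']
  calc _ ≤ (sbm n k c p q).real {G | 1 ≤ ∏ e, F e (G e)} := measureReal_mono hsub
    _ ≤ ∫ G, ∏ e, F e (G e) ∂sbm n k c p q := by
      have := mul_meas_ge_le_integral_of_nonneg (μ := sbm n k c p q)
        (f := fun G => ∏ e, F e (G e))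
        (Filter.Eventually.of_forall fun G => by
          simp only [Pi.zero_apply]; rw [hF]; positivity) Integrable.of_finite 1
      simpa using this
    _ = ∏ e, ∫ b, F e b ∂bern (if c e.1.1 = c e.1.2 then p else q) :=
      integral_fintype_prod_eq_prod _
    _ ≤ ∏ e, if e ∈ pairDiff c c' then Real.exp (-((p - q) ^ 2 / (16 * p))) else 1 :=
      Finset.prod_le_prod (fun e _ => integral_nonneg fun b => (Real.exp_pos _).le)
        fun e _ => hfac e
    _ = _ := by
      rw [Finset.prod_ite_mem, Finset.univ_inter, Finset.prod_const, ← Real.exp_nat_mul]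
      congr 1; ring

/-- The vertices that exactly one of the two clusterings puts together with `v`. -/
def vertexDiff {n k : ℕ} (c c' : Fin n → Fin k) (v : Fin n) : Finset (Fin n) :=
  Finset.univ.filter fun u => ¬(c v = c u ↔ c' v = c' u)

lemma sum_card_vertexDiff_le {n k : ℕ} (c c' : Fin n → Fin k) :
    ∑ v, (vertexDiff c c' v).card ≤ 2 * (pairDiff c c').card := by
  have h1 : ∑ v, (vertexDiff c c' v).card = (Finset.univ.sigma (vertexDiff c c')).card :=
    (Finset.card_sigma _ _).symm
  let f : {e : Fin n × Fin n // e.1 < e.2} → (_ : Fin n) × Fin n := fun e => ⟨e.1.1, e.1.2⟩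
  let g : {e : Fin n × Fin n // e.1 < e.2} → (_ : Fin n) × Fin n := fun e => ⟨e.1.2, e.1.1⟩
  have h2 : Finset.univ.sigma (vertexDiff c c') ⊆
      (pairDiff c c').image f ∪ (pairDiff c c').image g := by
    rintro ⟨u, v⟩ h
    simp only [vertexDiff, Finset.mem_sigma, Finset.mem_univ, true_and, Finset.mem_filter] at h
    rcases lt_trichotomy u v with huv | rfl | huv
    · exact Finset.mem_union_left _
        (Finset.mem_image.2 ⟨⟨(u, v), huv⟩, by simpa [pairDiff] using h, rfl⟩)
    · simp at h
    · refine Finset.mem_union_right _ (Finset.mem_image.2 ⟨⟨(v, u), huv⟩, ?_, rfl⟩)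
      simp only [pairDiff, Finset.mem_filter, Finset.mem_univ, true_and]
      rwa [eq_comm (a := c v), eq_comm (a := c' v)]
  rw [h1, two_mul]
  exact (Finset.card_le_card h2).trans ((Finset.card_union_le _ _).trans
    (add_le_add Finset.card_image_le Finset.card_image_le))

/-- Two different clusterings with large clusters have many disagreements. -/
lemma le_sum_card_vertexDiff {n k : ℕ} {m : ℝ} {c c' : Fin n → Fin k}
    (hc : ∀ i, m ≤ (clusterF c i).card) (hc' : ∀ i, m ≤ (clusterF c' i).card) {u v : Fin n}
    (h : u ∈ vertexDiff c c' v) :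
    m ≤ ∑ w, ((vertexDiff c c' w).card : ℝ) := by
  have key (s : Finset (Fin n)) (hs : s ⊆ vertexDiff c c' u ∪ vertexDiff c c' v)
      (hm : m ≤ s.card) : m ≤ ∑ w, ((vertexDiff c c' w).card : ℝ) := by
    have huv : u ≠ v := by
      rintro rfl
      simp [vertexDiff] at h
    calc m ≤ (s.card : ℝ) := hm
      _ ≤ (vertexDiff c c' u).card + (vertexDiff c c' v).card := by
        exact_mod_cast (Finset.card_le_card hs).trans (Finset.card_union_le _ _)
      _ = ∑ w ∈ ({u, v} : Finset (Fin n)), ((vertexDiff c c' w).card : ℝ) := by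
        rw [Finset.sum_pair huv]
      _ ≤ _ := Finset.sum_le_univ_sum_of_nonneg fun w => by positivity
  simp only [vertexDiff, Finset.mem_filter, Finset.mem_univ, true_and] at h
  by_cases h1 : c v = c u
  · refine key (clusterF c (c v)) ?_ (hc _)
    intro w hw
    simp only [clusterF, vertexDiff, Finset.mem_union, Finset.mem_filter, Finset.mem_univ,
      true_and] at hw ⊢
    grind
  · refine key (clusterF c' (c' v)) ?_ (hc' _)
    intro w hw
    simp only [clusterF, vertexDiff, Finset.mem_union, Finset.mem_filter, Finset.mem_univ,
      true_and] at hw ⊢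
    grind

lemma image_clusterF_eq {n k : ℕ} {c c' : Fin n → Fin k} (hc : Function.Surjective c)
    (hc' : Function.Surjective c') (h : ∀ u v, c v = c u ↔ c' v = c' u) :
    Finset.image (clusterF c) Finset.univ = Finset.image (clusterF c') Finset.univ := by
  have key (v : Fin n) : clusterF c (c v) = clusterF c' (c' v) := by
    ext u
    simp [clusterF, h]
  ext s
  simp only [Finset.mem_image, Finset.mem_univ, true_and]
  rw [hc.exists, hc'.exists]
  simp only [key]

/-- Vertices with few disagreements in a common cluster of one clustering stay together in the other. -/
lemma eq_of_card_vertexDiff_lt {n k : ℕ} {m : ℝ} {c c' : Fin n → Fin k}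
    (hc : ∀ i, m ≤ (clusterF c i).card) {u v : Fin n} (huv : c u = c v)
    (hu : ((vertexDiff c c' u).card : ℝ) < m / 2) (hv : ((vertexDiff c c' v).card : ℝ) < m / 2) :
    c' u = c' v := by
  by_contra hne
  have hs : clusterF c (c u) ⊆ vertexDiff c c' u ∪ vertexDiff c c' v := by
    intro w hw
    simp only [clusterF, vertexDiff, Finset.mem_union, Finset.mem_filter, Finset.mem_univ,
      true_and] at hw ⊢
    grind
  have : ((clusterF c (c u)).card : ℝ) ≤ (vertexDiff c c' u).card + (vertexDiff c c' v).card := by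
    exact_mod_cast (Finset.card_le_card hs).trans (Finset.card_union_le _ _)
  linarith [hc (c u)]

/-- Encoding of a clustering by a relabelling of `c` and a list of exceptional values. -/
lemma exists_code {n k : ℕ} {m : ℝ} {c c' : Fin n → Fin k}
    (hc : ∀ i, m ≤ (clusterF c i).card) (hc' : ∀ i, m ≤ (clusterF c' i).card)
    (hne : ∃ u v, u ∈ vertexDiff c c' v) :
    ∃ x : (Fin k → Fin k) × (Fin n → Option (Fin k)),
      (c' = fun v => (x.2 v).getD (x.1 (c v))) ∧
      m / 4 + m / 8 * (Finset.univ.filter fun v => x.2 v ≠ none).card ≤ (pairDiff c c').card := by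
  classical
  let B : Finset (Fin n) := Finset.univ.filter fun v => m / 2 ≤ ((vertexDiff c c' v).card : ℝ)
  have hlt (v : Fin n) (hv : v ∉ B) : ((vertexDiff c c' v).card : ℝ) < m / 2 := by
    simpa [B] using hv
  let π : Fin k → Fin k := fun i => if h : ∃ v, v ∉ B ∧ c v = i then c' h.choose else i
  refine ⟨(π, fun v => if v ∈ B then some (c' v) else none), ?_, ?_⟩
  · funext v
    by_cases hv : v ∈ B
    · simp [hv]
    · have h : ∃ u, u ∉ B ∧ c u = c v := ⟨v, hv, rfl⟩
      simp only [hv, if_false, Option.getD_none, π, dif_pos h]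
      exact eq_of_card_vertexDiff_lt hc h.choose_spec.2.symm (hlt v hv) (hlt _ h.choose_spec.1)
  · have hB : (Finset.univ.filter fun v => (if v ∈ B then some (c' v) else none) ≠ none) = B := by
      ext v; simp
    obtain ⟨u, v, huv⟩ := hne
    have h1 := le_sum_card_vertexDiff hc hc' huv
    have h2 : (∑ v, ((vertexDiff c c' v).card : ℝ)) ≤ 2 * (pairDiff c c').card := by
      exact_mod_cast sum_card_vertexDiff_le c c'
    have h3 : m / 2 * B.card ≤ ∑ v, ((vertexDiff c c' v).card : ℝ) := by
      calc m / 2 * B.card = ∑ v ∈ B, m / 2 := by rw [Finset.sum_const, nsmul_eq_mul, mul_comm]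
        _ ≤ ∑ v ∈ B, ((vertexDiff c c' v).card : ℝ) :=
          Finset.sum_le_sum fun v hv => (Finset.mem_filter.1 hv).2
        _ ≤ _ := Finset.sum_le_univ_sum_of_nonneg fun w => by positivity
    simp only [hB]
    linarith

lemma sum_exp_neg_card_ne_none (n k : ℕ) (a : ℝ) :
    ∑ h : Fin n → Option (Fin k),
      Real.exp (-(a * (Finset.univ.filter fun v => h v ≠ none).card)) =
      (1 + k * Real.exp (-a)) ^ n := by
  have h1 (h : Fin n → Option (Fin k)) :
      Real.exp (-(a * (Finset.univ.filter fun v => h v ≠ none).card)) =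
      ∏ v, if h v ≠ none then Real.exp (-a) else 1 := by
    rw [Finset.prod_ite, Finset.prod_const, Finset.prod_const_one, mul_one, ← Real.exp_nat_mul]
    congr 1; ring
  simp only [h1]
  have := Finset.prod_univ_sum (fun _ : Fin n => (Finset.univ : Finset (Option (Fin k))))
    (fun _ o => if o ≠ none then Real.exp (-a) else 1)
  rw [Fintype.piFinset_univ] at this
  rw [← this]
  simp

/-- Union bound over all competitors. -/
lemma sum_exp_pairDiff_le {n k : ℕ} {m κ : ℝ} (hκ : 0 ≤ κ) {c : Fin n → Fin k}
    (hc : ∀ i, m ≤ (clusterF c i).card) (s : Finset (Fin n → Fin k))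
    (hs : ∀ c' ∈ s, (∀ i, m ≤ (clusterF c' i).card) ∧ ∃ u v, u ∈ vertexDiff c c' v) :
    ∑ c' ∈ s, Real.exp (-κ * (pairDiff c c').card) ≤
      k ^ k * Real.exp (-(κ * m / 4)) * (1 + k * Real.exp (-(κ * m / 8))) ^ n := by
  classical
  have : Nonempty ((Fin k → Fin k) × (Fin n → Option (Fin k))) := ⟨(id, fun _ => none)⟩
  choose! x hx hm using fun c' (h : c' ∈ s) => exists_code hc (hs c' h).1 (hs c' h).2
  let w (y : (Fin k → Fin k) × (Fin n → Option (Fin k))) : ℝ :=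
    Real.exp (-(κ * m / 4)) *
      Real.exp (-(κ * m / 8 * (Finset.univ.filter fun v => y.2 v ≠ none).card))
  have hinj : Set.InjOn x s := fun a ha b hb hab => by
    rw [hx a ha, hx b hb, hab]
  calc _ ≤ ∑ c' ∈ s, w (x c') := by
        refine Finset.sum_le_sum fun c' h => ?_
        simp only [w]
        rw [← Real.exp_add, Real.exp_le_exp]
        have := mul_le_mul_of_nonneg_left (hm c' h) hκ
        linarith
    _ = ∑ y ∈ s.image x, w y := (Finset.sum_image hinj).symm
    _ ≤ ∑ y, w y := Finset.sum_le_univ_sum_of_nonneg fun y => by positivity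
    _ = _ := by
      rw [Fintype.sum_prod_type]
      simp only [w, ← Finset.mul_sum, sum_exp_neg_card_ne_none]
      simp only [Finset.sum_const, Finset.card_univ, Fintype.card_pi_const, Fintype.card_fin,
        nsmul_eq_mul, Nat.cast_pow]
      ring

/-- The signal condition makes the union bound summable. -/
lemma signal_lower_bound {n k : ℕ} (hk : 0 < k) {p q L : ℝ} (hq : 0 < q) (hqp : q < p)
    (hp : p ≤ 3 / 4) (hL : 1 ≤ L)
    (h : 128 * sigSBM p q * Real.sqrt k * L < (p - q) * Real.sqrt ((n : ℝ) / k)) :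
    128 * (k * L) ≤ (p - q) ^ 2 / (16 * p) * ((n : ℝ) / (2 * k)) := by
  have hp0 : 0 < p := hq.trans hqp
  have hk0 : (0 : ℝ) < k := by exact_mod_cast hk
  have hσ0 : 0 ≤ sigSBM p q := (Real.sqrt_nonneg _).trans (le_max_left _ _)
  have hσ : p / 4 ≤ sigSBM p q ^ 2 := by
    have h1 : Real.sqrt (p * (1 - p)) ^ 2 ≤ sigSBM p q ^ 2 :=
      pow_le_pow_left₀ (Real.sqrt_nonneg _) (le_max_left _ _) 2
    rw [Real.sq_sqrt (by nlinarith)] at h1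
    nlinarith
  have h2 := pow_le_pow_left₀ (by positivity) h.le 2
  rw [mul_pow, mul_pow, mul_pow, mul_pow, Real.sq_sqrt hk0.le, Real.sq_sqrt (by positivity)] at h2
  have h3 : 128 ^ 2 * (p / 4) * k * L ≤ (p - q) ^ 2 * (n / k) :=
    calc 128 ^ 2 * (p / 4) * k * L ≤ 128 ^ 2 * sigSBM p q ^ 2 * k * L ^ 2 := by
          gcongr
          nlinarith
      _ ≤ _ := h2
  have h4 : (p - q) ^ 2 / (16 * p) * ((n : ℝ) / (2 * k)) = (p - q) ^ 2 * (n / k) / (32 * p) := by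
    field_simp
    ring
  rw [h4, le_div_iff₀ (by positivity)]
  linarith

lemma union_bound_le {n k : ℕ} (hn : 0 < n) (hk : 0 < k) (hkn : k ≤ n) (hL : 0 ≤ Real.log n)
    {t : ℝ} (ht : 128 * (k * Real.log n) ≤ t) :
    k ^ k * Real.exp (-(t / 4)) * (1 + k * Real.exp (-(t / 8))) ^ n ≤ 3 / (n : ℝ) := by
  have hn0 : (0 : ℝ) < n := by exact_mod_cast hn
  have hk1 : (1 : ℝ) ≤ k := by exact_mod_cast hk
  have hkn' : (k : ℝ) ≤ n := by exact_mod_cast hkn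
  have hkL : Real.log n ≤ k * Real.log n := le_mul_of_one_le_left hL hk1
  have hinv : Real.exp (-Real.log n) = 1 / n := by
    rw [Real.exp_neg, Real.exp_log hn0, one_div]
  have h1 : (k : ℝ) ^ k ≤ Real.exp (k * Real.log n) := by
    rw [Real.exp_nat_mul, Real.exp_log hn0]
    gcongr
  have h2 : (k : ℝ) ^ k * Real.exp (-(t / 4)) ≤ 1 / n := by
    calc _ ≤ Real.exp (k * Real.log n) * Real.exp (-(t / 4)) := by gcongr
      _ ≤ Real.exp (-Real.log n) := by
        rw [← Real.exp_add, Real.exp_le_exp]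
        linarith
      _ = _ := hinv
  have h3 : k * Real.exp (-(t / 8)) ≤ 1 / n := by
    calc k * Real.exp (-(t / 8)) ≤ n * Real.exp (-Real.log n + -Real.log n) := by
          gcongr
          linarith
      _ = _ := by
        rw [Real.exp_add, hinv]
        field_simp
  have h4 : (1 + k * Real.exp (-(t / 8))) ^ n ≤ 3 :=
    calc (1 + k * Real.exp (-(t / 8))) ^ n ≤ Real.exp (1 / n) ^ n := by
          gcongr
          linarith [Real.add_one_le_exp (1 / (n : ℝ))]
      _ = Real.exp 1 := by
        rw [← Real.exp_nat_mul]
        congr 1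
        field_simp
      _ ≤ 3 := by linarith [Real.exp_one_lt_d9]
  calc _ ≤ 1 / (n : ℝ) * 3 := by gcongr
    _ = _ := by ring

/-- There exist absolute constants `C′, C₀ > 0`, `C₁ > 0` (the `O(1/n)` constant)
and `n₀` such that for all `n ≥ n₀`, for `G ~ SBM(n,k,p,q)` with `0 < q < p ≤ 3/4`,
`σ² ≥ C₀ log n / n`, every cluster of size at least `n/(2k)`, and
`(p−q)√(n/k) > C′·σ·√k·log n`, there is an estimator that with probability at least `1 − C₁/n`
outputs exactly the entire hidden partition `{V₁,…,V_k}`. -/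
theorem statement_2 :
    ∃ (C' C₀ C₁ : ℝ) (n₀ : ℕ), 0 < C' ∧ 0 < C₀ ∧ 0 < C₁ ∧
      ∀ (n k : ℕ), n₀ ≤ n →
        ∀ p q : ℝ, 0 < q → q < p → p ≤ 3 / 4 →
          C₀ * Real.log n / n ≤ (sigSBM p q) ^ 2 →
          ∃ f : ({e : Fin n × Fin n // e.1 < e.2} → Bool) → Finset (Finset (Fin n)),
            ∀ c : Fin n → Fin k,
              (∀ i : Fin k, (n : ℝ) / (2 * k) ≤ ((clusterF c i).card : ℝ)) →
              C' * sigSBM p q * Real.sqrt k * Real.log n < (p - q) * Real.sqrt ((n : ℝ) / k) →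
              ENNReal.ofReal (1 - C₁ / n) ≤
                sbm n k c p q
                  {G | f G = Finset.image (fun i => clusterF c i) Finset.univ} := by
  classical
  refine ⟨128, 1, 3, 3, by norm_num, by norm_num, by norm_num, ?_⟩
  intro n k hn p q hq hqp hp _
  let part (c : Fin n → Fin k) : Finset (Finset (Fin n)) :=
    Finset.image (fun i => clusterF c i) Finset.univ
  let valid (c : Fin n → Fin k) : Prop := ∀ i, (n : ℝ) / (2 * k) ≤ ((clusterF c i).card : ℝ)
  let opt (G : {e : Fin n × Fin n // e.1 < e.2} → Bool) (c : Fin n → Fin k) : Prop :=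
    valid c ∧ ∀ c', valid c' → part c' ≠ part c →
      score ((p + q) / 2) c' G < score ((p + q) / 2) c G
  refine ⟨fun G => if h : ∃ c, opt G c then part h.choose else ∅, fun c hc hsig => ?_⟩
  have hn0 : 0 < n := by omega
  have hk : 0 < k := (c ⟨0, hn0⟩).pos
  have hn1 : (0 : ℝ) < n := by exact_mod_cast hn0
  have hk1 : (0 : ℝ) < k := by exact_mod_cast hk
  have hsurj (c' : Fin n → Fin k) (h : valid c') : Function.Surjective c' := by
    intro i
    have h1 : (0 : ℝ) < (clusterF c' i).card := lt_of_lt_of_le (by positivity) (h i)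
    obtain ⟨v, hv⟩ := Finset.card_pos.1 (by exact_mod_cast h1)
    exact ⟨v, by simpa [clusterF] using hv⟩
  have hkn : k ≤ n := by simpa using Fintype.card_le_of_surjective c (hsurj c hc)
  have hL : 1 ≤ Real.log n := by
    rw [Real.le_log_iff_exp_le hn1]
    have : (3 : ℝ) ≤ n := by exact_mod_cast hn
    linarith [Real.exp_one_lt_d9]
  have := isProbabilityMeasure_sbm c hq hqp (by linarith)
  let s : Finset (Fin n → Fin k) := Finset.univ.filter fun c' => valid c' ∧ part c' ≠ part c
  let U : Set ({e : Fin n × Fin n // e.1 < e.2} → Bool) :=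
    ⋃ c' ∈ s, {G | score ((p + q) / 2) c G ≤ score ((p + q) / 2) c' G}
  have hU : (sbm n k c p q).real U ≤ 3 / n := by
    calc _ ≤ ∑ c' ∈ s, (sbm n k c p q).real
          {G | score ((p + q) / 2) c G ≤ score ((p + q) / 2) c' G} :=
          measureReal_biUnion_finset_le _ _
      _ ≤ ∑ c' ∈ s, Real.exp (-((p - q) ^ 2 / (16 * p)) * (pairDiff c c').card) :=
          Finset.sum_le_sum fun c' _ => sbm_score_le_score c c' hq hqp (by linarith)
      _ ≤ _ := by
        refine sum_exp_pairDiff_le (div_nonneg (sq_nonneg _) (by linarith)) hc s fun c' h => ?_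
        obtain ⟨hv, hne⟩ := (Finset.mem_filter.1 h).2
        refine ⟨hv, ?_⟩
        by_contra! hno
        refine hne (image_clusterF_eq (hsurj c hc) (hsurj c' hv) fun u v => ?_).symm
        have := hno u v
        simpa [vertexDiff] using this
      _ ≤ _ := union_bound_le hn0 hk hkn (by linarith) (signal_lower_bound hk hq hqp hp hL hsig)
  have hsub : Uᶜ ⊆ {G | (if h : ∃ c, opt G c then part h.choose else ∅) = part c} := by
    intro G hG
    have hopt : opt G c := by
      refine ⟨hc, fun c' hv hne => ?_⟩
      by_contra! hle
      exact hG (Set.mem_biUnion (Finset.mem_coe.2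
        (Finset.mem_filter.2 ⟨Finset.mem_univ c', hv, hne⟩)) hle)
    have h : ∃ c, opt G c := ⟨c, hopt⟩
    simp only [Set.mem_ofPred_eq, dif_pos h]
    by_contra hne
    exact lt_asymm (hopt.2 _ h.choose_spec.1 hne) (h.choose_spec.2 c hc (Ne.symm hne))
  calc ENNReal.ofReal (1 - 3 / n) ≤ ENNReal.ofReal ((sbm n k c p q).real Uᶜ) := by
        rw [probReal_compl_eq_one_sub U.toFinite.measurableSet]
        gcongr
    _ = sbm n k c p q Uᶜ := ofReal_measureReal
    _ ≤ _ := measure_mono hsub
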